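/- Let G be a finite simple graph. Suppose there exists a vertex v of G such that the neighborhood N(v) induces an independent set and no vertex of N(v) is θ-distinct in G − v. Then for every integer a ≥ 0, G is not a minimal forbidden induced subgraph for a-HNG; that is, it is not the case that χ(G) + θ(G) < |G| + 1 − a while every proper induced subgraph H of G satisfies χ(H) + θ(H) ≥ |H| + 1 − a. -/

import Mathlib

open SimpleGraph

/-- The chromatic number of `G` as a natural number. -/
noncomputable def chi {V : Type*} (G : SimpleGraph V) : ℕ := G.chromaticNumber.toNat

/-- The clique cover number of `G`: the chromatic number of the complement. -/
noncomputable def theta {V : Type*} (G : SimpleGraph V) : ℕ := chi Gᶜ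

/-- `G` is `a`-hereditary-Nordhaus-Gaddum: every induced subgraph `H`
satisfies `χ(H) + θ(H) ≥ |H| + 1 - a`. -/
def IsHNG {V : Type*} [Fintype V] (G : SimpleGraph V) (a : ℕ) : Prop :=
  ∀ s : Finset V, s.card + 1 - a ≤ chi (G.induce (s : Set V)) + theta (G.induce (s : Set V))

/-- `v` is `χ`-distinct in `G`: some proper coloring of `G` with `χ(G)` colors
has `v` alone in its color class. -/
def ChiDistinct {V : Type*} (G : SimpleGraph V) (v : V) : Prop :=
  ∃ C : G.Coloring (Fin (chi G)), ∀ w, C w = C v → w = v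

/-- `v` is `θ`-distinct in `G`: some partition of `V(G)` into `θ(G)` cliques
(equivalently, some proper coloring of the complement with `θ(G)` colors) has
`{v}` as one of its blocks. -/
def ThetaDistinct {V : Type*} (G : SimpleGraph V) (v : V) : Prop :=
  ∃ C : Gᶜ.Coloring (Fin (theta G)), ∀ w, C w = C v → w = v

theorem chi_le_of_colorable {V : Type*} {G : SimpleGraph V} {n : ℕ} (h : G.Colorable n) :
    chi G ≤ n :=
  ENat.toNat_le_of_le_natCast h.chromaticNumber_le

theorem colorable_chi {V : Type*} [Finite V] (G : SimpleGraph V) : G.Colorable (chi G) :=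
  colorable_chromaticNumber_of_fintype G

/-- A coloring of the complement of `G` restricts to the complement of an induced subgraph. -/
def complColoringInduce {V α : Type*} {G : SimpleGraph V} (C : Gᶜ.Coloring α) (s : Set V) :
    (G.induce s)ᶜ.Coloring α :=
  Coloring.mk (fun x => C x) fun {x y} hxy => by
    rw [compl_adj, comap_adj] at hxy
    exact C.valid ((compl_adj _ _ _).2 ⟨fun e => hxy.1 (Subtype.ext e), hxy.2⟩)

theorem chi_induce_le {V : Type*} [Finite V] (G : SimpleGraph V) (s : Set V) :
    chi (G.induce s) ≤ chi G :=
  chi_le_of_colorable ((colorable_chi G).of_hom (Embedding.induce s).toHom)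

theorem thetaDistinct_of_coloring {V : Type*} {G : SimpleGraph V} {n : ℕ} (hn : n = theta G)
    (C : Gᶜ.Coloring (Fin n)) {v : V} (hC : ∀ w, C w = C v → w = v) : ThetaDistinct G v := by
  subst hn
  exact ⟨C, hC⟩

theorem theta_induce_compl_singleton_lt {V : Type*} [Finite V] (G : SimpleGraph V) (v : V)
    (hind : (G.neighborSet v).Pairwise fun a b => ¬ G.Adj a b)
    (h : ∀ w : ({v}ᶜ : Set V), (w : V) ∈ G.neighborSet v →
      ¬ ThetaDistinct (G.induce ({v}ᶜ : Set V)) w) :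
    theta (G.induce ({v}ᶜ : Set V)) < theta G := by
  obtain ⟨C⟩ : Gᶜ.Colorable (theta G) := colorable_chi Gᶜ
  have hadj : ∀ x y, x ≠ y → C x = C y → G.Adj x y := fun x y hne he => by
    by_contra hxy
    exact C.valid ((compl_adj _ _ _).2 ⟨hne, hxy⟩) he
  by_cases hw : ∃ w, w ≠ v ∧ C w = C v
  · obtain ⟨w, hwv, hCw⟩ := hw
    have hvw : G.Adj v w := hadj v w hwv.symm hCw.symm
    refine lt_of_le_of_ne (chi_le_of_colorable ⟨complColoringInduce C _⟩) fun he => ?_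
    refine h ⟨w, hwv⟩ hvw (thetaDistinct_of_coloring he.symm (complColoringInduce C _) ?_)
    rintro ⟨x, hxv⟩ hx
    have hCx : C x = C w := hx
    by_contra hne
    have hxw : x ≠ w := fun e => hne (Subtype.ext e)
    exact hind (hadj v x (Ne.symm hxv) (hCx.trans hCw).symm) hvw hxw (hadj x w hxw hCx)
  · push Not at hw
    let D : (G.induce ({v}ᶜ : Set V))ᶜ.Coloring {c // c ≠ C v} :=
      Coloring.mk (fun x => ⟨C x, hw x x.2⟩) fun hxy e =>
        (complColoringInduce C _).valid hxy (congrArg Subtype.val e)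
    have hle : theta (G.induce ({v}ᶜ : Set V)) ≤ _ := chi_le_of_colorable D.colorable
    have hpos := (C v).pos
    rw [Fintype.card_subtype_compl, Fintype.card_fin, Fintype.card_subtype_eq] at hle
    omega

/-- If some vertex `v` has independent neighborhood and no neighbor of `v` is
`θ`-distinct in `G - v`, then for no `a ≥ 0` is `G` a minimal forbidden induced
subgraph for `a`-HNG. -/
theorem stmt_9 {V : Type*} [Fintype V] (G : SimpleGraph V) (v : V)
    (hind : (G.neighborSet v).Pairwise fun a b => ¬ G.Adj a b)
    (h : ∀ w : ({v}ᶜ : Set V), (w : V) ∈ G.neighborSet v →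
      ¬ ThetaDistinct (G.induce ({v}ᶜ : Set V)) w) :
    ∀ a : ℕ, ¬ (chi G + theta G < Fintype.card V + 1 - a ∧
      ∀ s : Finset V, s ≠ Finset.univ →
        s.card + 1 - a ≤ chi (G.induce (s : Set V)) + theta (G.induce (s : Set V))) := by
  classical
  rintro a ⟨hlt, hmin⟩
  have hθ := theta_induce_compl_singleton_lt G v hind h
  have hχ := chi_induce_le G ({v}ᶜ : Set V)
  have hs := hmin {v}ᶜ (by simp [Finset.compl_eq_univ_iff])
  rw [Finset.coe_compl, Finset.coe_singleton, Finset.card_compl, Finset.card_singleton] at hs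
  omega
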